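/- The linear automorphism μ₀ of F⁶ given by (y₀, y₁, y₂, y₃, y₄, y₅) ↦ (y₀ + y₅, y₁, y₂, y₃, y₄, y₅) induces a collineation of PG(5,3) that fixes every point [v] with v₅ = 0 (in particular it fixes every point of Δ_{0,j} for every j ∈ F) and maps Δ_{k,j} onto Δ_{k,j+1} for every k ∈ {1, 2, ∞} and every j ∈ F. -/

import Mathlib

/-- `F = GF(3)` realized as `ZMod 3`. -/
abbrev F3 := ZMod 3

/-- `PG(5,3)`: the projective space of `F³ ⁶` (projectivization of `Fin 6 → F`). -/
abbrev PG5 := Projectivization F3 (Fin 6 → F3)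

/-- `v` is a representative vector of the projective point `Q`. -/
def IsRep6 (v : Fin 6 → F3) (Q : PG5) : Prop :=
  ∃ hv : v ≠ 0, Projectivization.mk F3 v hv = Q

/-- The set `K ⊆ PG(5,3)`. -/
def Kset : Set PG5 :=
  {Q | ∃ x₀ x₁ x₂ : F3, (x₁, x₂) ≠ (0, 0) ∧
    IsRep6 ![x₀ ^ 2 + 1, x₀ * x₁, x₀ * x₂, x₁ ^ 2, x₁ * x₂, x₂ ^ 2] Q}


/-- For `k ∈ F ∪ {∞}` (with `none` playing the role of `∞`), the pair
`(a_k, b_k) := (1, k)` for `k ∈ F` and `(a_∞, b_∞) := (0, 1)`. -/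
def abk : Option F3 → F3 × F3
  | some k => (1, k)
  | none => (0, 1)

/-- The set `Δ_{k,j} = { [(u²+j, u·a_k, u·b_k, a_k², a_k·b_k, b_k²)] : u ∈ F }`. -/
def Δ (k : Option F3) (j : F3) : Set PG5 :=
  {Q | ∃ u : F3,
    IsRep6 ![u ^ 2 + j, u * (abk k).1, u * (abk k).2,
      (abk k).1 ^ 2, (abk k).1 * (abk k).2, (abk k).2 ^ 2] Q}

/-- The point `P = [(1,0,0,0,0,0)]` of the Veronese surface. -/
def Ppt : PG5 := Projectivization.mk F3 ![1, 0, 0, 0, 0, 0] (by decide)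

/-- The linear automorphism `μ₀` of `F⁶` given by
`(y₀, y₁, y₂, y₃, y₄, y₅) ↦ (y₀ + y₅, y₁, y₂, y₃, y₄, y₅)`. -/
def μ₀ : (Fin 6 → F3) ≃ₗ[F3] (Fin 6 → F3) :=
  LinearEquiv.ofLinear
    (Matrix.toLin' !![1, 0, 0, 0, 0, 1; 0, 1, 0, 0, 0, 0; 0, 0, 1, 0, 0, 0;
      0, 0, 0, 1, 0, 0; 0, 0, 0, 0, 1, 0; 0, 0, 0, 0, 0, 1])
    (Matrix.toLin' !![1, 0, 0, 0, 0, 2; 0, 1, 0, 0, 0, 0; 0, 0, 1, 0, 0, 0;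
      0, 0, 0, 1, 0, 0; 0, 0, 0, 0, 1, 0; 0, 0, 0, 0, 0, 1])
    (by
      rw [← Matrix.toLin'_mul,
        show (!![1, 0, 0, 0, 0, 1; 0, 1, 0, 0, 0, 0; 0, 0, 1, 0, 0, 0;
            0, 0, 0, 1, 0, 0; 0, 0, 0, 0, 1, 0; 0, 0, 0, 0, 0, 1] :
            Matrix (Fin 6) (Fin 6) F3) *
          !![1, 0, 0, 0, 0, 2; 0, 1, 0, 0, 0, 0; 0, 0, 1, 0, 0, 0;
            0, 0, 0, 1, 0, 0; 0, 0, 0, 0, 1, 0; 0, 0, 0, 0, 0, 1] = 1 by decide,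
        Matrix.toLin'_one])
    (by
      rw [← Matrix.toLin'_mul,
        show (!![1, 0, 0, 0, 0, 2; 0, 1, 0, 0, 0, 0; 0, 0, 1, 0, 0, 0;
            0, 0, 0, 1, 0, 0; 0, 0, 0, 0, 1, 0; 0, 0, 0, 0, 0, 1] :
            Matrix (Fin 6) (Fin 6) F3) *
          !![1, 0, 0, 0, 0, 1; 0, 1, 0, 0, 0, 0; 0, 0, 1, 0, 0, 0;
            0, 0, 0, 1, 0, 0; 0, 0, 0, 0, 1, 0; 0, 0, 0, 0, 0, 1] = 1 by decide,
        Matrix.toLin'_one])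

/-- The collineation of `PG(5,3)` induced by `μ₀`. -/
noncomputable def mapμ₀ : PG5 → PG5 :=
  Projectivization.map μ₀.toLinearMap (μ₀.injective)

theorem μ₀_apply (v : Fin 6 → F3) : μ₀ v = ![v 0 + v 5, v 1, v 2, v 3, v 4, v 5] := by
  ext i
  fin_cases i <;> simp [μ₀, Matrix.mulVec, dotProduct, Fin.sum_univ_six]

theorem IsRep6.mapμ₀ {v : Fin 6 → F3} {Q : PG5} (h : IsRep6 v Q) :
    IsRep6 (μ₀ v) (mapμ₀ Q) := by
  obtain ⟨hv, rfl⟩ := h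
  exact ⟨μ₀.map_ne_zero_iff.mpr hv, rfl⟩

theorem IsRep6.eq {v : Fin 6 → F3} {Q R : PG5} (hQ : IsRep6 v Q) (hR : IsRep6 v R) :
    Q = R := by
  obtain ⟨_, rfl⟩ := hQ
  obtain ⟨_, rfl⟩ := hR
  rfl

theorem IsRep6.mapμ₀_eq_self {v : Fin 6 → F3} {Q : PG5} (h : IsRep6 v Q) (h5 : v 5 = 0) :
    _root_.mapμ₀ Q = Q := by
  refine h.mapμ₀.eq ?_
  have hfix : μ₀ v = v := by
    rw [μ₀_apply]
    ext i
    fin_cases i <;> simp [h5]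
  rwa [hfix]

/-- `μ₀` maps `Δ_{k,j}` onto `Δ_{k,j+1}` as soon as `b_k² = 1`. -/
theorem mapμ₀_image_Δ {k : Option F3} (hk : (abk k).2 ^ 2 = 1) (j : F3) :
    mapμ₀ '' Δ k j = Δ k (j + 1) := by
  have key (u : F3) :
      μ₀ ![u ^ 2 + j, u * (abk k).1, u * (abk k).2,
        (abk k).1 ^ 2, (abk k).1 * (abk k).2, (abk k).2 ^ 2] =
      ![u ^ 2 + (j + 1), u * (abk k).1, u * (abk k).2,
        (abk k).1 ^ 2, (abk k).1 * (abk k).2, (abk k).2 ^ 2] := by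
    rw [μ₀_apply]
    simp [hk, add_assoc]
  ext Q
  constructor
  · rintro ⟨R, ⟨u, hR⟩, rfl⟩
    exact ⟨u, key u ▸ hR.mapμ₀⟩
  · rintro ⟨u, hQ⟩
    rw [← key u] at hQ
    obtain ⟨hv, rfl⟩ := hQ
    exact ⟨_, ⟨u, μ₀.map_ne_zero_iff.mp hv, rfl⟩, rfl⟩

/-- The linear automorphism `μ₀ : (y₀,…,y₅) ↦ (y₀+y₅, y₁, y₂, y₃, y₄, y₅)`
induces a collineation of `PG(5,3)` that fixes every point `[v]` with `v₅ = 0` (in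
particular every point of `Δ_{0,j}` for every `j ∈ F`) and maps `Δ_{k,j}` onto
`Δ_{k,j+1}` for every `k ∈ {1, 2, ∞}` and every `j ∈ F`. -/
theorem mu_zero_properties :
    (∀ v : Fin 6 → F3, μ₀ v = ![v 0 + v 5, v 1, v 2, v 3, v 4, v 5]) ∧
    (∀ (Q : PG5) (v : Fin 6 → F3), IsRep6 v Q → v 5 = 0 → mapμ₀ Q = Q) ∧
    (∀ j : F3, ∀ Q ∈ Δ (some 0) j, mapμ₀ Q = Q) ∧
    (∀ k ∈ ({some 1, some 2, none} : Set (Option F3)), ∀ j : F3,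
      mapμ₀ '' Δ k j = Δ k (j + 1)) := by
  refine ⟨μ₀_apply, fun Q v h h5 => h.mapμ₀_eq_self h5, ?_, ?_⟩
  · rintro j Q ⟨u, h⟩
    exact h.mapμ₀_eq_self (by simp [abk])
  · rintro k (rfl | rfl | rfl) j <;> exact mapμ₀_image_Δ (by decide) j
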